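/- There exists a smooth nondecreasing function Ψ : ℝ → ℝ with 0 ≤ Ψ ≤ 1, Ψ(x) = 0 for x ≤ −1, Ψ(x) = 1 for x ≥ 1, and a constant C > 0 such that (Ψ′(x))² ≤ CΨ(x) and (Ψ″(x))² ≤ CΨ′(x) for all x ∈ ℝ. -/

import Mathlib

/-- A nonnegative function whose second derivative is bounded above by `M` satisfies
`f'² ≤ 2 M f`. -/
theorem sq_deriv_le_of_deriv_deriv_le {f : ℝ → ℝ} {M : ℝ} (hf : Differentiable ℝ f)
    (hf' : Differentiable ℝ (deriv f)) (hM : 0 < M) (h0 : ∀ x, 0 ≤ f x)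
    (h2 : ∀ x, deriv (deriv f) x ≤ M) (x : ℝ) : deriv f x ^ 2 ≤ 2 * M * f x := by
  have hd : ∀ y, HasDerivAt (fun y => M / 2 * y ^ 2 - f y) (M * y - deriv f y) y := fun y => by
    refine (((hasDerivAt_pow 2 y).const_mul (M / 2)).sub (hf y).hasDerivAt).congr_deriv ?_
    push_cast
    ring
  have hd2 : ∀ y, HasDerivAt (fun y => M * y - deriv f y) (M - deriv (deriv f) y) y := fun y => by
    exact (((hasDerivAt_id y).const_mul M).sub (hf' y).hasDerivAt).congr_deriv (by simp)
  have hconv : ConvexOn ℝ Set.univ (fun y => M / 2 * y ^ 2 - f y) := by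
    refine Monotone.convexOn_univ_of_deriv (fun y => (hd y).differentiableAt) ?_
    rw [funext fun y => (hd y).deriv]
    refine monotone_of_deriv_nonneg (fun y => (hd2 y).differentiableAt) fun y => ?_
    rw [(hd2 y).deriv]
    exact sub_nonneg.2 (h2 y)
  have htangent : ∀ y, f y ≤ f x + deriv f x * (y - x) + M / 2 * (y - x) ^ 2 := fun y => by
    rcases lt_trichotomy x y with hxy | rfl | hxy
    · have h := hconv.le_slope_of_hasDerivAt (Set.mem_univ x) (Set.mem_univ y) hxy (hd x)
      rw [slope_def_field, le_div_iff₀ (sub_pos.2 hxy)] at h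
      linarith
    · simp
    · have h := hconv.slope_le_of_hasDerivAt (Set.mem_univ y) (Set.mem_univ x) hxy (hd x)
      rw [slope_def_field, div_le_iff₀ (sub_pos.2 hxy)] at h
      linarith
  have h := (h0 _).trans (htangent (x - deriv f x / M))
  have heq : f x + deriv f x * (x - deriv f x / M - x) + M / 2 * (x - deriv f x / M - x) ^ 2
      = (2 * M * f x - deriv f x ^ 2) / (2 * M) := by
    field_simp
    ring
  rw [heq, le_div_iff₀ (by positivity)] at h
  linarith

/-- There exists a smooth nondecreasing cutoff `Ψ : ℝ → ℝ` with `0 ≤ Ψ ≤ 1`, `Ψ = 0` on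
`(-∞, −1]`, `Ψ = 1` on `[1, ∞)`, and a constant `C > 0` with `(Ψ′)² ≤ CΨ` and
`(Ψ″)² ≤ CΨ′` everywhere. -/
theorem stmt6 :
    ∃ Ψ : ℝ → ℝ, ContDiff ℝ (⊤ : ℕ∞) Ψ ∧ Monotone Ψ ∧
      (∀ x, 0 ≤ Ψ x ∧ Ψ x ≤ 1) ∧
      (∀ x ≤ (-1 : ℝ), Ψ x = 0) ∧ (∀ x, (1 : ℝ) ≤ x → Ψ x = 1) ∧
      ∃ C > (0:ℝ), ∀ x, (deriv Ψ x) ^ 2 ≤ C * Ψ x ∧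
        (deriv (deriv Ψ) x) ^ 2 ≤ C * deriv Ψ x := by
  obtain ⟨Ψ, hΨ⟩ : ∃ Ψ : ℝ → ℝ, Ψ = fun x => Real.smoothTransition ((x + 1) / 2) := ⟨_, rfl⟩
  have hsmooth : ContDiff ℝ (⊤ : ℕ∞) Ψ := by
    rw [hΨ]
    exact Real.smoothTransition.contDiff.comp (by fun_prop)
  have hmono : Monotone Ψ := by
    rw [hΨ]
    exact fun x y hxy => Real.smoothTransition.monotone (by linarith)
  have hbounds : ∀ x, 0 ≤ Ψ x ∧ Ψ x ≤ 1 := fun x => by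
    rw [hΨ]
    exact ⟨Real.smoothTransition.nonneg _, Real.smoothTransition.le_one _⟩
  have hzero : ∀ x ≤ (-1 : ℝ), Ψ x = 0 := fun x hx => by
    rw [hΨ]
    exact Real.smoothTransition.zero_of_nonpos (by linarith)
  have hone : ∀ x, (1 : ℝ) ≤ x → Ψ x = 1 := fun x hx => by
    rw [hΨ]
    exact Real.smoothTransition.one_of_one_le (by linarith)
  have hsmooth1 := (contDiff_infty_iff_deriv.1 hsmooth).2
  have hsmooth2 := (contDiff_infty_iff_deriv.1 hsmooth1).2
  have hsmooth3 := (contDiff_infty_iff_deriv.1 hsmooth2).2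
  have hsupp : HasCompactSupport (deriv Ψ) := by
    refine HasCompactSupport.intro (isCompact_Icc (a := (-1 : ℝ)) (b := 1)) fun x hx => ?_
    rcases lt_or_ge x (-1) with h | h
    · have heq : Ψ =ᶠ[nhds x] fun _ => 0 := by
        filter_upwards [Iio_mem_nhds h] with y hy using hzero y (le_of_lt hy)
      simp [heq.deriv_eq]
    · have h1 : 1 < x := not_le.1 fun h' => hx ⟨h, h'⟩
      have heq : Ψ =ᶠ[nhds x] fun _ => 1 := by
        filter_upwards [Ioi_mem_nhds h1] with y hy using hone y (le_of_lt hy)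
      simp [heq.deriv_eq]
  obtain ⟨A, hA⟩ := hsupp.deriv.exists_bound_of_continuous hsmooth2.continuous
  obtain ⟨B, hB⟩ := hsupp.deriv.deriv.exists_bound_of_continuous hsmooth3.continuous
  have hM : 0 < max (max A B) 1 := lt_max_of_lt_right one_pos
  refine ⟨Ψ, hsmooth, hmono, hbounds, hzero, hone, 2 * max (max A B) 1, by positivity,
    fun x => ⟨?_, ?_⟩⟩
  · exact sq_deriv_le_of_deriv_deriv_le (hsmooth.differentiable (by simp))
      (hsmooth1.differentiable (by simp)) hM (fun y => (hbounds y).1)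
      (fun y => (le_abs_self _).trans ((hA y).trans (by simp))) x
  · exact sq_deriv_le_of_deriv_deriv_le (hsmooth1.differentiable (by simp))
      (hsmooth2.differentiable (by simp)) hM (fun y => hmono.deriv_nonneg)
      (fun y => (le_abs_self _).trans ((hB y).trans (by simp))) x
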